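/- (Tensor homogeneous S-lemma) Let m be even, F_0,...,F_p symmetric m-th order n-dimensional tensors, and suppose there is a nonsingular matrix P with P^m F_l essentially nonpositive for all l. Assume Slater's condition: there exists x_0 with ⟨F_l, x_0^{⊗m}⟩ < 0 for l = 1,...,p. Then the implication [⟨F_l, x^{⊗m}⟩ ≤ 0 for all l = 1,...,p ⟹ ⟨F_0, x^{⊗m}⟩ ≥ 0] holds if and only if there exist λ_l ≥ 0 (l = 1,...,p) such that x ↦ ⟨F_0 + ∑_{l=1}^p λ_l F_l, x^{⊗m}⟩ is a sum-of-squares polynomial. -/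

import Mathlib

open Finset MvPolynomial

noncomputable section

/-- Entrywise inner product of two m-th order n-dimensional tensors. -/
def tIP {m n : ℕ} (A B : (Fin m → Fin n) → ℝ) : ℝ :=
  ∑ i : Fin m → Fin n, A i * B i

/-- The rank-one tensor `x^{⊗m}` with entries `x_{i_1} ⋯ x_{i_m}`. -/
def rk1 {n : ℕ} (m : ℕ) (x : Fin n → ℝ) : (Fin m → Fin n) → ℝ :=
  fun i => ∏ k, x (i k)

/-- A tensor is symmetric if invariant under permutations of its indices. -/
def TSymm {m n : ℕ} (A : (Fin m → Fin n) → ℝ) : Prop :=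
  ∀ (σ : Equiv.Perm (Fin m)) (i : Fin m → Fin n), A (i ∘ σ) = A i

/-- Essentially nonpositive: entries with indices not all equal are ≤ 0. -/
def EssNonpos {m n : ℕ} (A : (Fin m → Fin n) → ℝ) : Prop :=
  ∀ i : Fin m → Fin n, (¬ ∀ k l, i k = i l) → A i ≤ 0

/-- `U_{m,n}`: convex hull of the rank-one tensors `x^{⊗m}`. -/
def Ucone (m n : ℕ) : Set ((Fin m → Fin n) → ℝ) :=
  convexHull ℝ {X | ∃ x : Fin n → ℝ, X = rk1 m x}

/-- The tensor `P^m A`. -/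
def pmul {m n : ℕ} (P : Matrix (Fin n) (Fin n) ℝ) (A : (Fin m → Fin n) → ℝ) :
    (Fin m → Fin n) → ℝ :=
  fun i => ∑ j : Fin m → Fin n, (∏ k, P (i k) (j k)) * A j

/-- A real-valued function on ℝⁿ is a sum of squares of polynomials. -/
def IsSOSFun {n : ℕ} (f : (Fin n → ℝ) → ℝ) : Prop :=
  ∃ (r : ℕ) (g : Fin r → MvPolynomial (Fin n) ℝ),
    ∀ x, f x = ∑ j, (MvPolynomial.eval x (g j)) ^ 2

/-- A polynomial is a sum of squares of polynomials. -/
def IsSOSPoly {n : ℕ} (f : MvPolynomial (Fin n) ℝ) : Prop :=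
  ∃ (r : ℕ) (g : Fin r → MvPolynomial (Fin n) ℝ), f = ∑ j, (g j) ^ 2

/-- A polynomial has essentially nonpositive coefficients (w.r.t. degree m):
    every coefficient except the constant term and those of `x_i^m` is ≤ 0. -/
def EssNonposCoeff {n : ℕ} (m : ℕ) (f : MvPolynomial (Fin n) ℝ) : Prop :=
  ∀ α : Fin n →₀ ℕ, α ≠ 0 → (∀ i, α ≠ Finsupp.single i m) → f.coeff α ≤ 0

/-- The M. Riesz extension theorem for a functional given on the source of an injective map. -/
theorem riesz_extension_of_injective {D E : Type*} [AddCommGroup D] [Module ℝ D]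
    [AddCommGroup E] [Module ℝ E] (s : PointedCone ℝ E) (j : D →ₗ[ℝ] E)
    (hj : Function.Injective j) (φ : D →ₗ[ℝ] ℝ) (nonneg : ∀ d, j d ∈ s → 0 ≤ φ d)
    (dense : ∀ y, ∃ d, j d + y ∈ s) :
    ∃ g : E →ₗ[ℝ] ℝ, (∀ d, g (j d) = φ d) ∧ ∀ x ∈ s, 0 ≤ g x := by
  let e := LinearEquiv.ofInjective j hj
  have he : ∀ d, e.symm ⟨j d, LinearMap.mem_range_self j d⟩ = d := fun d =>
    e.symm_apply_apply d
  let f : E →ₗ.[ℝ] ℝ := ⟨LinearMap.range j, φ ∘ₗ e.symm.toLinearMap⟩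
  have hf : ∀ d, f ⟨j d, LinearMap.mem_range_self j d⟩ = φ d := fun d =>
    congrArg φ (he d)
  obtain ⟨g, hg, hs⟩ := riesz_extension s f
    (by
      rintro ⟨_, d, rfl⟩ hx
      exact (hf d).symm ▸ nonneg d hx)
    (fun y => by
      obtain ⟨d, hd⟩ := dense y
      exact ⟨⟨j d, LinearMap.mem_range_self j d⟩, hd⟩)
  exact ⟨g, fun d => (hg ⟨j d, LinearMap.mem_range_self j d⟩).trans (hf d), hs⟩

/-- Positively homogeneous and subadditive on a convex cone. -/
structure SublinearOn {V : Type*} [AddCommGroup V] [Module ℝ V] (K : PointedCone ℝ V)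
    (f : V → ℝ) : Prop where
  map_smul : ∀ c : ℝ, 0 ≤ c → ∀ u ∈ K, f (c • u) = c * f u
  map_add : ∀ u ∈ K, ∀ v ∈ K, f (u + v) ≤ f u + f v

theorem SublinearOn.map_zero {V : Type*} [AddCommGroup V] [Module ℝ V] {K : PointedCone ℝ V}
    {f : V → ℝ} (hf : SublinearOn K f) : f 0 = 0 := by
  simpa using hf.map_smul 0 le_rfl 0 K.zero_mem

/-- Lagrange multipliers for a homogeneous convex program under Slater's condition. -/
theorem exists_multipliers_of_slater {V : Type*} [AddCommGroup V] [Module ℝ V]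
    {K : PointedCone ℝ V} {ι : Type*} [Fintype ι] {f₀ : V → ℝ} {f : ι → V → ℝ}
    (hf₀ : SublinearOn K f₀) (hf : ∀ l, SublinearOn K (f l))
    (slater : ∃ u ∈ K, ∀ l, f l u < 0)
    (h : ∀ u ∈ K, (∀ l, f l u ≤ 0) → 0 ≤ f₀ u) :
    ∃ lam : ι → ℝ, (∀ l, 0 ≤ lam l) ∧ ∀ u ∈ K, 0 ≤ f₀ u + ∑ l, lam l * f l u := by
  classical
  let S : PointedCone ℝ ((ι → ℝ) × ℝ) :=
    { carrier := {v | ∃ u ∈ K, (∀ l, f l u ≤ v.1 l) ∧ f₀ u ≤ v.2}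
      add_mem' := by
        rintro v w ⟨a, ha, hav, ha₀⟩ ⟨b, hb, hbw, hb₀⟩
        exact ⟨a + b, K.add_mem ha hb,
          fun l => ((hf l).map_add a ha b hb).trans (add_le_add (hav l) (hbw l)),
          (hf₀.map_add a ha b hb).trans (add_le_add ha₀ hb₀)⟩
      zero_mem' := ⟨0, K.zero_mem, fun l => (hf l).map_zero.le, hf₀.map_zero.le⟩
      smul_mem' := by
        rintro c v ⟨a, ha, hav, ha₀⟩
        refine ⟨(c : ℝ) • a, K.smul_mem c.2 ha, fun l => ?_, ?_⟩
        · rw [(hf l).map_smul c c.2 a ha]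
          exact mul_le_mul_of_nonneg_left (hav l) c.2
        · rw [hf₀.map_smul c c.2 a ha]
          exact mul_le_mul_of_nonneg_left ha₀ c.2 }
  obtain ⟨g, hg, hS⟩ := riesz_extension_of_injective S (LinearMap.inr ℝ (ι → ℝ) ℝ)
    LinearMap.inr_injective LinearMap.id
    (by
      rintro t ⟨u, hu, hl, h₀⟩
      exact (h u hu hl).trans h₀)
    (by
      rintro ⟨v, t⟩
      obtain ⟨u, hu, hneg⟩ := slater
      obtain ⟨c, hc, hcv⟩ : ∃ c : ℝ, 0 ≤ c ∧ ∀ l, c * f l u ≤ v l := by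
        refine ⟨∑ l, |v l| / -f l u, ?_, fun l => ?_⟩
        · exact Finset.sum_nonneg fun l _ =>
            div_nonneg (abs_nonneg _) (neg_pos.2 (hneg l)).le
        · have h1 : |v l| / -f l u ≤ ∑ l, |v l| / -f l u :=
            Finset.single_le_sum (f := fun l => |v l| / -f l u) (fun l _ =>
              div_nonneg (abs_nonneg _) (neg_pos.2 (hneg l)).le) (Finset.mem_univ l)
          rw [div_le_iff₀ (neg_pos.2 (hneg l))] at h1
          linarith [neg_abs_le (v l)]
      refine ⟨f₀ (c • u) - t, c • u, K.smul_mem hc hu, fun l => ?_, ?_⟩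
      · rw [(hf l).map_smul c hc u hu]
        simpa using hcv l
      · simp)
  have hsplit : ∀ v t, g (v, t) = ∑ l, v l * g (Pi.single l 1, 0) + t := by
    intro v t
    have h1 : ((v, t) : (ι → ℝ) × ℝ) =
        ∑ l, v l • ((Pi.single l 1, 0) : (ι → ℝ) × ℝ) + LinearMap.inr ℝ (ι → ℝ) ℝ t := by
      ext l
      · simp [Prod.fst_sum, Finset.sum_apply, Pi.single_apply]
      · simp [Prod.snd_sum]
    rw [h1, map_add, hg, map_sum]
    simp only [map_smul, smul_eq_mul, LinearMap.id_apply]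
  refine ⟨fun l => g (Pi.single l 1, 0), fun l => hS _ ⟨0, K.zero_mem, fun k => ?_, ?_⟩,
    fun u hu => ?_⟩
  · rw [(hf k).map_zero]
    simp only [Pi.single_apply]
    split_ifs <;> simp
  · exact hf₀.map_zero.le
  · have := hS (fun l => f l u, f₀ u) ⟨u, hu, fun l => le_rfl, le_rfl⟩
    rw [hsplit] at this
    simp only [mul_comm (g _)]
    linarith

/-- If a linear functional plus a sum of sublinear functions is nonnegative on a cone, the
functional can be distributed over the summands. -/
theorem exists_sum_eq_of_nonneg {V : Type*} [AddCommGroup V] [Module ℝ V]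
    {K : PointedCone ℝ V} {ι : Type*} [Fintype ι] [Nonempty ι] {h : ι → V → ℝ}
    (hh : ∀ i, SublinearOn K (h i)) (hK : ∀ y : ι → V, ∃ v, ∀ i, v + y i ∈ K)
    (φ : V →ₗ[ℝ] ℝ) (hφ : ∀ u ∈ K, 0 ≤ φ u + ∑ i, h i u) :
    ∃ ψ : ι → V →ₗ[ℝ] ℝ, (∀ u, ∑ i, ψ i u = φ u) ∧ ∀ i, ∀ u ∈ K, 0 ≤ ψ i u + h i u := by
  classical
  obtain ⟨i₀⟩ := ‹Nonempty ι›
  let S : PointedCone ℝ ((ι → V) × ℝ) :=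
    { carrier := {v | (∀ i, v.1 i ∈ K) ∧ ∑ i, h i (v.1 i) ≤ v.2}
      add_mem' := by
        rintro v w ⟨hv, hv'⟩ ⟨hw, hw'⟩
        refine ⟨fun i => K.add_mem (hv i) (hw i), ?_⟩
        refine le_trans ?_ (add_le_add hv' hw')
        rw [← Finset.sum_add_distrib]
        exact Finset.sum_le_sum fun i _ => (hh i).map_add _ (hv i) _ (hw i)
      zero_mem' := ⟨fun i => K.zero_mem, by simp [(hh _).map_zero]⟩
      smul_mem' := by
        rintro c v ⟨hv, hv'⟩
        refine ⟨fun i => K.smul_mem c.2 (hv i), ?_⟩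
        have : ∑ i, h i ((c • v).1 i) = c * ∑ i, h i (v.1 i) := by
          rw [Finset.mul_sum]
          exact Finset.sum_congr rfl fun i _ => (hh i).map_smul c c.2 _ (hv i)
        rw [this]
        exact mul_le_mul_of_nonneg_left hv' c.2 }
  let j : V × ℝ →ₗ[ℝ] (ι → V) × ℝ :=
    LinearMap.prodMap (LinearMap.pi fun _ => LinearMap.id) LinearMap.id
  obtain ⟨g, hg, hS⟩ := riesz_extension_of_injective S j
    (by
      rintro ⟨u, s⟩ ⟨v, t⟩ huv
      have h1 := congrFun (congrArg Prod.fst huv) i₀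
      have h2 := congrArg Prod.snd huv
      exact Prod.ext h1 h2)
    (φ.coprod LinearMap.id)
    (by
      rintro ⟨u, t⟩ ⟨hu, ht⟩
      exact (hφ u (hu i₀)).trans (add_le_add le_rfl ht))
    (by
      rintro ⟨y, t⟩
      obtain ⟨v, hv⟩ := hK y
      exact ⟨(v, ∑ i, h i (v + y i) - t), hv, by simp [j]⟩)
  have hg1 : ∀ t, g (0, t) = t := fun t => by
    have := hg (0, t)
    simpa [j] using this
  refine ⟨fun i => g ∘ₗ LinearMap.inl ℝ _ ℝ ∘ₗ LinearMap.single ℝ (fun _ => V) i,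
    fun u => ?_, fun i u hu => ?_⟩
  · have h1 := hg (u, 0)
    simp only [LinearMap.coe_comp, Function.comp_apply]
    rw [← map_sum, ← map_sum]
    have h2 : ∑ i, LinearMap.single ℝ (fun _ => V) i u = fun _ : ι => u :=
      Finset.univ_sum_single fun _ : ι => u
    rw [h2]
    exact h1.trans (by simp)
  · have h1 := hS (Pi.single i u, h i u) ⟨fun k => ?_, ?_⟩
    · have h2 : ((Pi.single i u, h i u) : (ι → V) × ℝ) = (Pi.single i u, 0) + (0, h i u) := by
        simp
      rw [h2, map_add, hg1] at h1
      exact h1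
    · rcases eq_or_ne k i with rfl | hk
      · simpa using hu
      · simp [hk]
    · refine le_of_eq ?_
      simp only
      rw [Finset.sum_eq_single i]
      · simp
      · intro k _ hk
        simp [hk, (hh k).map_zero]
      · simp

theorem IsSumSq.real_smul {R : Type*} [CommRing R] [Algebra ℝ R] {r : ℝ} (hr : 0 ≤ r) {s : R}
    (hs : IsSumSq s) : IsSumSq (r • s) := by
  have : r • s = algebraMap ℝ R √r * algebraMap ℝ R √r * s := by
    rw [← map_mul, Real.mul_self_sqrt hr, Algebra.smul_def]
  rw [this]
  exact (IsSumSq.mul_self _).mul hs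

theorem IsSumSq.pow {R : Type*} [CommSemiring R] {s : R} (hs : IsSumSq s) (k : ℕ) :
    IsSumSq (s ^ k) := by
  simpa using IsSumSq.prod (I := Finset.range k) (x := fun _ => s) fun _ _ => hs

theorem IsSumSq.of_even_pow {R : Type*} [CommSemiring R] (x : R) {k : ℕ} (hk : Even k) :
    IsSumSq (x ^ k) :=
  (hk.isSquare_pow x).isSumSq

theorem IsSumSq.sub_mul_pow_sub_pow {R : Type*} [CommRing R] {x y : R} (hx : IsSumSq x)
    (hy : IsSumSq y) (d : ℕ) : IsSumSq ((x - y) * (x ^ d - y ^ d)) := by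
  have : (x - y) * (x ^ d - y ^ d) =
      (x - y) * (x - y) * ∑ i ∈ Finset.range d, x ^ i * y ^ (d - 1 - i) := by
    rw [← Commute.geom_sum₂_mul (Commute.all x y) d]
    ring
  rw [this]
  exact (IsSumSq.mul_self _).mul (IsSumSq.sum fun i _ => (hx.pow _).mul (hy.pow _))

/-- The arithmetic-geometric mean inequality for sums of squares, as an algebraic identity. -/
theorem IsSumSq.sum_pow_sub_prod {R ι : Type*} [CommRing R] [Algebra ℝ R] {z : ι → R}
    (d : ℕ) : ∀ s : Finset ι, s.card = d → (∀ i ∈ s, IsSumSq (z i)) →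
    IsSumSq (∑ i ∈ s, z i ^ d - (d : R) * ∏ i ∈ s, z i) := by
  classical
  induction d with
  | zero =>
    intro s hs _
    simp [Finset.card_eq_zero.1 hs]
  | succ d ih =>
    intro s hs hz
    rcases Nat.eq_zero_or_pos d with rfl | hd
    · obtain ⟨a, rfl⟩ := Finset.card_eq_one.1 hs
      simp
    have h1 : IsSumSq (∑ j ∈ s, z j *
        (∑ i ∈ s.erase j, z i ^ d - (d : R) * ∏ i ∈ s.erase j, z i)) :=
      IsSumSq.sum fun j hj => (hz j hj).mul
        (ih _ (by rw [Finset.card_erase_of_mem hj, hs]; rfl)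
          fun i hi => hz i (Finset.mem_of_mem_erase hi))
    have h2 : IsSumSq (∑ j ∈ s, ∑ i ∈ s, (z i - z j) * (z i ^ d - z j ^ d)) :=
      IsSumSq.sum fun j hj => IsSumSq.sum fun i hi =>
        (hz i hi).sub_mul_pow_sub_pow (hz j hj) d
    have e1 : ∑ j ∈ s, z j * (∑ i ∈ s.erase j, z i ^ d - (d : R) * ∏ i ∈ s.erase j, z i) =
        (∑ j ∈ s, z j) * (∑ i ∈ s, z i ^ d) - ∑ j ∈ s, z j ^ (d + 1)
          - (d : R) * ((d + 1 : ℕ) * ∏ i ∈ s, z i) := by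
      have : ∀ j ∈ s, z j * (∑ i ∈ s.erase j, z i ^ d - (d : R) * ∏ i ∈ s.erase j, z i) =
          z j * (∑ i ∈ s, z i ^ d) - z j ^ (d + 1) - (d : R) * ∏ i ∈ s, z i := by
        intro j hj
        rw [← Finset.add_sum_erase s _ hj, ← Finset.mul_prod_erase s z hj]
        ring
      rw [Finset.sum_congr rfl this]
      simp only [Finset.sum_sub_distrib, Finset.sum_const, hs, ← Finset.sum_mul, nsmul_eq_mul]
      ring
    have e2 : ∑ j ∈ s, ∑ i ∈ s, (z i - z j) * (z i ^ d - z j ^ d) =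
        2 * (d + 1 : ℕ) * ∑ j ∈ s, z j ^ (d + 1)
          - 2 * ((∑ j ∈ s, z j) * (∑ i ∈ s, z i ^ d)) := by
      have : ∀ j i, (z i - z j) * (z i ^ d - z j ^ d) =
          z i ^ (d + 1) + z j ^ (d + 1) - z j * z i ^ d - z i * z j ^ d := by
        intro j i
        ring
      simp only [this, Finset.sum_sub_distrib, Finset.sum_add_distrib, Finset.sum_const, hs,
        ← Finset.sum_mul, ← Finset.mul_sum, nsmul_eq_mul]
      ring
    have h3 : IsSumSq ((2 * d : ℝ)⁻¹ • (2 * (∑ j ∈ s, z j *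
        (∑ i ∈ s.erase j, z i ^ d - (d : R) * ∏ i ∈ s.erase j, z i)) +
        ∑ j ∈ s, ∑ i ∈ s, (z i - z j) * (z i ^ d - z j ^ d))) := by
      refine IsSumSq.real_smul (by positivity) (IsSumSq.add ?_ h2)
      exact (by simpa using IsSumSq.natCast (R := R) 2 : IsSumSq (2 : R)).mul h1
    convert h3 using 1
    rw [e1, e2, eq_inv_smul_iff₀ (by positivity), Algebra.smul_def]
    simp only [map_mul, map_ofNat, map_natCast]
    push_cast
    ring

/-- Hurwitz: the arithmetic-geometric mean form in an even number of variables is a sum of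
squares. -/
theorem IsSumSq.sum_even_pow_sub_prod {R ι : Type*} [CommRing R] [Algebra ℝ R] (y : ι → R)
    (s : Finset ι) (hs : Even s.card) :
    IsSumSq (∑ i ∈ s, y i ^ s.card - (s.card : R) * ∏ i ∈ s, y i) := by
  classical
  obtain ⟨d, hd⟩ := hs
  obtain ⟨t, hts, htd⟩ := Finset.exists_subset_card_eq (show d ≤ s.card by omega)
  have hcard : (s \ t).card = d := by
    rw [Finset.card_sdiff_of_subset hts]
    omega
  have hsq : ∀ i, IsSumSq (y i ^ 2) := fun i => IsSumSq.of_even_pow _ even_two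
  have h1 := IsSumSq.sum_pow_sub_prod d t htd fun i _ => hsq i
  have h2 := IsSumSq.sum_pow_sub_prod d (s \ t) hcard fun i _ => hsq i
  have h3 := (IsSumSq.natCast (R := R) d).mul
    (IsSumSq.mul_self (∏ i ∈ t, y i - ∏ i ∈ s \ t, y i))
  refine (congrArg IsSumSq ?_).mpr ((h1.add h2).add h3)
  rw [← Finset.sum_sdiff hts, ← Finset.prod_sdiff hts, hd]
  simp only [Finset.prod_pow, ← pow_mul, two_mul]
  push_cast
  ring

theorem sum_comp_eq_sum_card_smul {κ ι M : Type*} [Fintype κ] [Fintype ι] [DecidableEq ι]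
    [AddCommGroup M] [Module ℝ M] (i : κ → ι) (F : ι → M) :
    ∑ k, F (i k) = ∑ j, ((Finset.univ.filter fun k => i k = j).card : ℝ) • F j := by
  rw [← Finset.sum_fiberwise' Finset.univ i F]
  simp [Nat.cast_smul_eq_nsmul]

/-- A nonnegative form consisting of pure powers minus one monomial is a sum of squares. -/
theorem IsSumSq.sum_smul_pow_sub_monomial {R : Type*} [CommRing R] [Algebra ℝ R] {m n : ℕ}
    (hm : Even m) (hm0 : 0 < m) (i : Fin m → Fin n) (w : Fin n → ℝ) {c : ℝ} (hw : ∀ j, 0 ≤ w j)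
    (hc : 0 ≤ c)
    (h : ∀ x : Fin n → ℝ, (∀ j, 0 ≤ x j) → c * ∏ k, x (i k) ≤ ∑ j, w j * x j ^ m)
    (Y : Fin n → R) :
    IsSumSq (∑ j, w j • Y j ^ m - c • ∏ k, Y (i k)) := by
  classical
  rcases hc.eq_or_lt with rfl | hc
  · simpa using IsSumSq.sum fun j _ => (IsSumSq.of_even_pow (Y j) hm).real_smul (hw j)
  have hmR : (0 : ℝ) < m := by exact_mod_cast hm0
  have hpos : ∀ k, 0 < w (i k) := by
    intro k
    by_contra hk
    have hk0 : w (i k) = 0 := le_antisymm (not_lt.1 hk) (hw _)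
    set W := ∑ j, w j with hW
    have hW0 : 0 ≤ W := Finset.sum_nonneg fun j _ => hw j
    let X : ℝ := 1 + W / c
    have hX1 : 1 ≤ X := le_add_of_nonneg_right (by positivity)
    have hx := h (fun j => if j = i k then X else 1) (fun j => by split_ifs <;> positivity)
    have h1 : ∑ j, w j * (if j = i k then X else 1) ^ m = W := by
      refine Finset.sum_congr rfl fun j _ => ?_
      split_ifs with hj
      · rw [hj, hk0, zero_mul]
      · simp
    have h2 : X ≤ ∏ l, (if i l = i k then X else 1) := by
      rw [← Finset.mul_prod_erase _ _ (Finset.mem_univ k)]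
      simp only [if_true]
      refine le_mul_of_one_le_right (by linarith) ?_
      exact Finset.one_le_prod fun l _ => by split_ifs <;> simp [hX1]
    rw [h1] at hx
    have h3 := (mul_le_mul_of_nonneg_left h2 hc.le).trans hx
    have h4 : c * X = c + W := by
      simp only [X]
      field_simp
    linarith
  let α : Fin n → ℝ := fun j => ((Finset.univ.filter fun k => i k = j).card : ℝ)
  have hα0 : ∀ j, 0 ≤ α j := fun j => Nat.cast_nonneg _
  have hα1 : ∑ j, α j = m := by
    have := sum_comp_eq_sum_card_smul i (fun _ => (1 : ℝ))
    simpa [α] using this.symm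
  have hαi : ∀ k, 0 < α (i k) := fun k =>
    Nat.cast_pos.2 (Finset.card_pos.2 ⟨k, by simp⟩)
  have hαw : ∀ j, α j ≠ 0 → 0 < w j := by
    intro j hj
    obtain ⟨k, hk⟩ := Finset.card_pos.1 (Nat.pos_of_ne_zero (Nat.cast_ne_zero.1 hj))
    rw [← (Finset.mem_filter.1 hk).2]
    exact hpos k
  let s : Fin n → ℝ := fun j => (α j / (m * w j)) ^ (m : ℝ)⁻¹
  have hq : ∀ j, 0 ≤ α j / (m * w j) := fun j =>
    div_nonneg (hα0 j) (mul_nonneg hmR.le (hw j))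
  have hs0 : ∀ j, 0 ≤ s j := fun j => Real.rpow_nonneg (hq j) _
  have hsm : ∀ j, s j ^ m = α j / (m * w j) := fun j => Real.rpow_inv_natCast_pow (hq j) hm0.ne'
  have hsi : ∀ k, s (i k) ≠ 0 := fun k =>
    (Real.rpow_pos_of_pos (div_pos (hαi k) (mul_pos hmR (hpos k))) _).ne'
  have hws : ∀ j, w j * s j ^ m = α j / m := by
    intro j
    rw [hsm]
    by_cases hj : α j = 0
    · simp [hj]
    · have := (hαw j hj).ne'
      field_simp
  set π : ℝ := c * ∏ k, s (i k) with hπ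
  have hπ0 : 0 ≤ π := mul_nonneg hc.le (Finset.prod_nonneg fun k _ => hs0 _)
  have hπ1 : π ≤ 1 := by
    refine (h s hs0).trans_eq ?_
    simp only [hws]
    rw [← Finset.sum_div, hα1, div_self hmR.ne']
  let Z : Fin n → R := fun j => (s j)⁻¹ • Y j
  have hprod : c • ∏ k, Y (i k) = π • ∏ k, Z (i k) := by
    have : ∀ k, Y (i k) = s (i k) • Z (i k) := fun k => (smul_inv_smul₀ (hsi k) _).symm
    rw [Finset.prod_congr rfl fun k _ => this k, Finset.prod_smul, smul_smul]
  have hZ : ∑ k, Z (i k) ^ m = ∑ j, α j • Z j ^ m :=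
    sum_comp_eq_sum_card_smul i fun j => Z j ^ m
  have h1 : IsSumSq (∑ j, (w j • Y j ^ m - (m : ℝ)⁻¹ • α j • Z j ^ m)) := by
    refine IsSumSq.sum fun j _ => ?_
    by_cases hj : α j = 0
    · simpa [hj] using (IsSumSq.of_even_pow (Y j) hm).real_smul (hw j)
    · have h2 : (m : ℝ)⁻¹ • α j • Z j ^ m = w j • Y j ^ m := by
        have h3 := (hαw j hj).ne'
        simp only [Z]
        rw [smul_pow, smul_smul, smul_smul, inv_pow, hsm]
        congr 1
        field_simp
      rw [h2, sub_self]
      exact IsSumSq.zero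
  have h2 : IsSumSq (∑ k, Z (i k) ^ m - (m : R) * ∏ k, Z (i k)) := by
    simpa using IsSumSq.sum_even_pow_sub_prod (fun k => Z (i k)) Finset.univ (by simpa using hm)
  have h3 : IsSumSq (∑ k, Z (i k) ^ m) := IsSumSq.sum fun k _ => IsSumSq.of_even_pow _ hm
  have h4 := (h1.add ((h2.real_smul hπ0).real_smul (inv_nonneg.2 hmR.le))).add
    ((h3.real_smul (sub_nonneg.2 hπ1)).real_smul (inv_nonneg.2 hmR.le))
  refine (congrArg IsSumSq ?_).mpr h4
  have h5 : (m : R) * ∏ k, Z (i k) = (m : ℝ) • ∏ k, Z (i k) := by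
    rw [Algebra.smul_def, map_natCast]
  rw [hprod, Finset.sum_sub_distrib, ← Finset.smul_sum, ← hZ, h5, smul_sub π, smul_sub,
    smul_comm π (m : ℝ), inv_smul_smul₀ hmR.ne']
  module

/-- The geometric mean is superadditive on nonnegative reals. -/
theorem prod_rpow_add_prod_rpow_le {ι : Type*} [Fintype ι] [Nonempty ι] {a b : ι → ℝ}
    (ha : ∀ k, 0 ≤ a k) (hb : ∀ k, 0 ≤ b k) :
    ∏ k, a k ^ (Fintype.card ι : ℝ)⁻¹ + ∏ k, b k ^ (Fintype.card ι : ℝ)⁻¹ ≤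
      ∏ k, (a k + b k) ^ (Fintype.card ι : ℝ)⁻¹ := by
  set r : ℝ := (Fintype.card ι : ℝ)⁻¹ with hr
  have hcard : (0 : ℝ) < Fintype.card ι := by exact_mod_cast Fintype.card_pos
  have hr0 : 0 < r := inv_pos.2 hcard
  by_cases hz : ∃ k, a k + b k = 0
  · obtain ⟨k, hk⟩ := hz
    have hak : a k = 0 := by linarith [ha k, hb k]
    have hbk : b k = 0 := by linarith [ha k, hb k]
    rw [Finset.prod_eq_zero (Finset.mem_univ k) (by rw [hak, Real.zero_rpow hr0.ne']),
      Finset.prod_eq_zero (f := fun k => b k ^ r) (Finset.mem_univ k)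
        (by rw [hbk, Real.zero_rpow hr0.ne']), add_zero]
    exact Finset.prod_nonneg fun k _ => Real.rpow_nonneg (add_nonneg (ha k) (hb k)) _
  · push Not at hz
    have hs : ∀ k, 0 < a k + b k := fun k => (add_nonneg (ha k) (hb k)).lt_of_ne' (hz k)
    have key : ∀ c : ι → ℝ, (∀ k, 0 ≤ c k) → ∏ k, c k ^ r ≤
        (∏ k, (a k + b k) ^ r) * ∑ k, r * (c k / (a k + b k)) := by
      intro c hc
      have h1 := Real.geom_mean_le_arith_mean_weighted Finset.univ (fun _ => r)
        (fun k => c k / (a k + b k)) (fun _ _ => hr0.le)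
        (by simp [hr, hcard.ne']) (fun k _ => div_nonneg (hc k) (hs k).le)
      refine le_trans (le_of_eq ?_) (mul_le_mul_of_nonneg_left h1
        (Finset.prod_nonneg fun k _ => Real.rpow_nonneg (hs k).le _))
      rw [← Finset.prod_mul_distrib]
      refine Finset.prod_congr rfl fun k _ => ?_
      rw [← Real.mul_rpow (hs k).le (div_nonneg (hc k) (hs k).le), mul_div_cancel₀ _ (hz k)]
    refine (add_le_add (key a ha) (key b hb)).trans_eq ?_
    rw [← mul_add, ← Finset.sum_add_distrib]
    have : ∀ k, r * (a k / (a k + b k)) + r * (b k / (a k + b k)) = r := fun k => by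
      rw [← mul_add, ← add_div, div_self (hz k), mul_one]
    rw [Finset.sum_congr rfl fun k _ => this k]
    simp [hr, hcard.ne']

/-- The negated off-diagonal part of a tensor. -/
def offDiagNeg {m n : ℕ} (G : (Fin m → Fin n) → ℝ) : (Fin m → Fin n) → ℝ :=
  open Classical in fun i => if ∃ j, i = fun _ => j then 0 else -G i

theorem EssNonpos.offDiagNeg_nonneg {m n : ℕ} (hm0 : 0 < m) {G : (Fin m → Fin n) → ℝ}
    (hG : EssNonpos G) (i : Fin m → Fin n) : 0 ≤ offDiagNeg G i := by
  unfold offDiagNeg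
  split_ifs with h
  · exact le_rfl
  · exact neg_nonneg.2 (hG i fun hc => h ⟨i ⟨0, hm0⟩, funext fun k => hc _ _⟩)

theorem sum_smul_prod_eq_diag_sub {m n : ℕ} (hm0 : 0 < m) {R : Type*} [CommRing R] [Algebra ℝ R]
    (G : (Fin m → Fin n) → ℝ) (Y : Fin n → R) :
    ∑ i, G i • ∏ k, Y (i k) =
      ∑ j, G (fun _ => j) • Y j ^ m - ∑ i, offDiagNeg G i • ∏ k, Y (i k) := by
  classical
  rw [eq_sub_iff_add_eq, ← Finset.sum_add_distrib]
  symm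
  refine Finset.sum_of_injOn (fun j _ => j) ?_ (fun _ _ => Finset.mem_coe.2 (Finset.mem_univ _))
    ?_ ?_
  · intro j _ j' _ h
    exact congrFun h ⟨0, hm0⟩
  · intro i _ hi
    have : ¬ ∃ j, i = fun _ => j := by
      rintro ⟨j, rfl⟩
      exact hi ⟨j, by simp, rfl⟩
    simp [offDiagNeg, this]
  · intro j _
    have : ∃ j', (fun _ : Fin m => j) = fun _ => j' := ⟨j, rfl⟩
    simp [offDiagNeg, this]

theorem tIP_rk1_eq_diag_sub {m n : ℕ} (hm0 : 0 < m) (G : (Fin m → Fin n) → ℝ) (x : Fin n → ℝ) :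
    tIP G (rk1 m x) =
      ∑ j, G (fun _ => j) * x j ^ m - ∑ i, offDiagNeg G i * ∏ k, x (i k) := by
  simpa [tIP, rk1] using sum_smul_prod_eq_diag_sub hm0 G x

theorem EssNonpos.tIP_rk1_abs_le {m n : ℕ} (hm : Even m) (hm0 : 0 < m)
    {G : (Fin m → Fin n) → ℝ} (hG : EssNonpos G) (x : Fin n → ℝ) :
    tIP G (rk1 m fun j => |x j|) ≤ tIP G (rk1 m x) := by
  rw [tIP_rk1_eq_diag_sub hm0, tIP_rk1_eq_diag_sub hm0]
  simp only [hm.pow_abs, ← Finset.abs_prod]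
  gcongr with i
  · exact hG.offDiagNeg_nonneg hm0 i
  · exact le_abs_self _

/-- The geometric mean of the entries of `u` selected by the multi-index `i`. -/
def geomMean {m n : ℕ} (i : Fin m → Fin n) (u : Fin n → ℝ) : ℝ :=
  ∏ k, u (i k) ^ (m : ℝ)⁻¹

theorem sublinearOn_const_mul_geomMean {m n : ℕ} (hm0 : 0 < m) (i : Fin m → Fin n) {c : ℝ}
    (hc : 0 ≤ c) :
    SublinearOn (PointedCone.positive ℝ (Fin n → ℝ)) fun u => -(c * geomMean i u) where
  map_smul t ht u hu := by
    have hu' : ∀ j, 0 ≤ u j := (PointedCone.mem_positive ℝ _).1 hu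
    have : geomMean i (t • u) = t * geomMean i u := by
      simp only [geomMean, Pi.smul_apply, smul_eq_mul, Real.mul_rpow ht (hu' _),
        Finset.prod_mul_distrib, Finset.prod_const, Finset.card_univ, Fintype.card_fin,
        Real.rpow_inv_natCast_pow ht hm0.ne']
    rw [this]
    ring
  map_add u hu v hv := by
    have hu' : ∀ j, 0 ≤ u j := (PointedCone.mem_positive ℝ _).1 hu
    have hv' : ∀ j, 0 ≤ v j := (PointedCone.mem_positive ℝ _).1 hv
    have : Nonempty (Fin m) := ⟨⟨0, hm0⟩⟩
    have h := prod_rpow_add_prod_rpow_le (fun k => hu' (i k)) (fun k => hv' (i k))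
    rw [Fintype.card_fin] at h
    have h' : geomMean i u + geomMean i v ≤ geomMean i (u + v) := h
    nlinarith [mul_le_mul_of_nonneg_left h' hc]

theorem tIP_rk1_rpow_inv {m n : ℕ} (hm0 : 0 < m) (G : (Fin m → Fin n) → ℝ) {u : Fin n → ℝ}
    (hu : ∀ j, 0 ≤ u j) :
    tIP G (rk1 m fun j => u j ^ (m : ℝ)⁻¹) =
      ∑ j, G (fun _ => j) * u j + ∑ i, -(offDiagNeg G i * geomMean i u) := by
  rw [tIP_rk1_eq_diag_sub hm0, Finset.sum_neg_distrib, ← sub_eq_add_neg]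
  simp only [Real.rpow_inv_natCast_pow (hu _) hm0.ne', geomMean]

theorem EssNonpos.sublinearOn {m n : ℕ} (hm0 : 0 < m) {G : (Fin m → Fin n) → ℝ}
    (hG : EssNonpos G) :
    SublinearOn (PointedCone.positive ℝ (Fin n → ℝ))
      fun u => tIP G (rk1 m fun j => u j ^ (m : ℝ)⁻¹) where
  map_smul t ht u hu := by
    have hu' : ∀ j, 0 ≤ u j := (PointedCone.mem_positive ℝ _).1 hu
    rw [tIP_rk1_rpow_inv hm0 G hu', tIP_rk1_rpow_inv hm0 G (u := t • u) fun j => mul_nonneg ht (hu' j),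
      mul_add, Finset.mul_sum, Finset.mul_sum]
    congr 1
    · exact Finset.sum_congr rfl fun j _ => by simp only [Pi.smul_apply, smul_eq_mul]; ring
    · exact Finset.sum_congr rfl fun i _ =>
        (sublinearOn_const_mul_geomMean hm0 i (hG.offDiagNeg_nonneg hm0 i)).map_smul t ht u hu
  map_add u hu v hv := by
    have hu' : ∀ j, 0 ≤ u j := (PointedCone.mem_positive ℝ _).1 hu
    have hv' : ∀ j, 0 ≤ v j := (PointedCone.mem_positive ℝ _).1 hv
    rw [tIP_rk1_rpow_inv hm0 G hu', tIP_rk1_rpow_inv hm0 G hv',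
      tIP_rk1_rpow_inv hm0 G (u := u + v) fun j => add_nonneg (hu' j) (hv' j)]
    have h1 : ∑ i, -(offDiagNeg G i * geomMean i (u + v)) ≤
        ∑ i, -(offDiagNeg G i * geomMean i u) + ∑ i, -(offDiagNeg G i * geomMean i v) := by
      rw [← Finset.sum_add_distrib]
      exact Finset.sum_le_sum fun i _ =>
        (sublinearOn_const_mul_geomMean hm0 i (hG.offDiagNeg_nonneg hm0 i)).map_add u hu v hv
    have h2 : ∑ j, G (fun _ => j) * (u + v) j =
        ∑ j, G (fun _ => j) * u j + ∑ j, G (fun _ => j) * v j := by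
      simp [mul_add, Finset.sum_add_distrib]
    linarith

/-- An essentially nonpositive form of even degree that is nonnegative on the orthant is a sum of
squares. -/
theorem EssNonpos.isSumSq {m n : ℕ} (hm : Even m) (hm0 : 0 < m) {G : (Fin m → Fin n) → ℝ}
    (hG : EssNonpos G)
    (h : ∀ u : Fin n → ℝ, (∀ j, 0 ≤ u j) → 0 ≤ tIP G (rk1 m fun j => u j ^ (m : ℝ)⁻¹))
    {R : Type*} [CommRing R] [Algebra ℝ R] (Y : Fin n → R) :
    IsSumSq (∑ i, G i • ∏ k, Y (i k)) := by
  classical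
  rcases isEmpty_or_nonempty (Fin m → Fin n) with hempty | hne
  · simp
  have hc := hG.offDiagNeg_nonneg hm0
  obtain ⟨ψ, hψ, hψ'⟩ := exists_sum_eq_of_nonneg
    (K := PointedCone.positive ℝ (Fin n → ℝ))
    (fun i => sublinearOn_const_mul_geomMean hm0 i (hc i))
    (fun y => by
      refine ⟨∑ i, |y i|, fun i => (PointedCone.mem_positive ℝ _).2 ?_⟩
      have h1 : |y i| ≤ ∑ i, |y i| :=
        Finset.single_le_sum (f := fun i => |y i|) (fun _ _ => abs_nonneg _) (Finset.mem_univ i)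
      exact neg_le_iff_add_nonneg.1 ((neg_le_abs (y i)).trans h1))
    (∑ j, G (fun _ => j) • LinearMap.proj j)
    (fun u hu => by
      have hu' : ∀ j, 0 ≤ u j := (PointedCone.mem_positive ℝ _).1 hu
      have h1 := h u hu'
      rw [tIP_rk1_rpow_inv hm0 G hu'] at h1
      simpa using h1)
  have hψe : ∀ i u, ψ i u = ∑ j, ψ i (Pi.single j 1) * u j := by
    intro i u
    rw [(ψ i).pi_apply_eq_sum_univ u]
    refine Finset.sum_congr rfl fun j _ => ?_
    rw [smul_eq_mul, mul_comm]
    congr 2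
    ext k
    simp [Pi.single_apply, eq_comm]
  have hdiag : ∀ j, G (fun _ => j) = ∑ i, ψ i (Pi.single j 1) := by
    intro j
    rw [hψ]
    simp [Pi.single_apply]
  have hw : ∀ i j, 0 ≤ ψ i (Pi.single j 1) := by
    intro i j
    have hj : (0 : Fin n → ℝ) ≤ Pi.single j 1 := Pi.single_nonneg.2 zero_le_one
    have h1 := hψ' i (Pi.single j 1) ((PointedCone.mem_positive ℝ _).2 hj)
    have h2 : 0 ≤ offDiagNeg G i * geomMean i (Pi.single j 1) :=
      mul_nonneg (hc i) (Finset.prod_nonneg fun k _ => Real.rpow_nonneg (hj _) _)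
    linarith
  rw [sum_smul_prod_eq_diag_sub hm0]
  have hsum : ∑ j, G (fun _ => j) • Y j ^ m - ∑ i, offDiagNeg G i • ∏ k, Y (i k) =
      ∑ i, (∑ j, ψ i (Pi.single j 1) • Y j ^ m - offDiagNeg G i • ∏ k, Y (i k)) := by
    rw [Finset.sum_sub_distrib, Finset.sum_comm]
    simp only [hdiag, Finset.sum_smul]
  rw [hsum]
  refine IsSumSq.sum fun i _ =>
    IsSumSq.sum_smul_pow_sub_monomial hm hm0 i _ (hw i) (hc i) (fun x hx => ?_) Y
  have h1 := hψ' i (fun j => x j ^ m)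
    ((PointedCone.mem_positive ℝ _).2 fun j => pow_nonneg (hx j) m)
  rw [hψe] at h1
  simp only [geomMean, Real.pow_rpow_inv_natCast (hx _) hm0.ne'] at h1
  linarith

theorem tIP_add_sum_smul {m n : ℕ} {ι : Type*} [Fintype ι] (A : (Fin m → Fin n) → ℝ)
    (B : ι → (Fin m → Fin n) → ℝ) (lam : ι → ℝ) (X : (Fin m → Fin n) → ℝ) :
    tIP (A + ∑ l, lam l • B l) X = tIP A X + ∑ l, lam l * tIP (B l) X := by
  simp only [tIP, Pi.add_apply, Finset.sum_apply, Pi.smul_apply, smul_eq_mul, add_mul,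
    Finset.sum_add_distrib, Finset.sum_mul, Finset.mul_sum, mul_assoc]
  rw [Finset.sum_comm]

theorem tIP_pmul_rk1 {m n : ℕ} (P : Matrix (Fin n) (Fin n) ℝ) (A : (Fin m → Fin n) → ℝ)
    (y : Fin n → ℝ) : tIP (pmul P A) (rk1 m y) = tIP A (rk1 m (Matrix.vecMul y P)) := by
  simp only [tIP, pmul, rk1, Matrix.vecMul, dotProduct, Finset.prod_univ_sum, Finset.sum_mul,
    Finset.mul_sum, Fintype.piFinset_univ]
  rw [Finset.sum_comm]
  refine Finset.sum_congr rfl fun j _ => Finset.sum_congr rfl fun i _ => ?_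
  rw [Finset.prod_mul_distrib]
  ring

theorem EssNonpos.add_sum_smul {m n : ℕ} {ι : Type*} [Fintype ι] {A : (Fin m → Fin n) → ℝ}
    {B : ι → (Fin m → Fin n) → ℝ} {lam : ι → ℝ} (hA : EssNonpos A) (hB : ∀ l, EssNonpos (B l))
    (hlam : ∀ l, 0 ≤ lam l) : EssNonpos (A + ∑ l, lam l • B l) := by
  intro i hi
  simp only [Pi.add_apply, Finset.sum_apply, Pi.smul_apply, smul_eq_mul]
  exact add_nonpos (hA i hi)
    (Finset.sum_nonpos fun l _ => mul_nonpos_of_nonneg_of_nonpos (hlam l) (hB l i hi))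

theorem IsSumSq.isSOSPoly {n : ℕ} {f : MvPolynomial (Fin n) ℝ} (hf : IsSumSq f) :
    IsSOSPoly f := by
  induction hf with
  | zero => exact ⟨0, Fin.elim0, by simp⟩
  | sq_add a _ ih =>
    obtain ⟨r, g, rfl⟩ := ih
    exact ⟨r + 1, Fin.cons a g, by simp [Fin.sum_univ_succ, pow_two]⟩

theorem IsSOSPoly.isSOSFun {n : ℕ} {f : MvPolynomial (Fin n) ℝ} (hf : IsSOSPoly f) :
    IsSOSFun fun x => MvPolynomial.eval x f := by
  obtain ⟨r, g, rfl⟩ := hf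
  exact ⟨r, g, fun x => by simp⟩

/-- Tensor analogy of the homogeneous S-lemma. -/
theorem stmt11 (m n p : ℕ) (hm : Even m) (hm0 : 0 < m)
    (F0 : (Fin m → Fin n) → ℝ) (F : Fin p → (Fin m → Fin n) → ℝ)
    (hF0s : TSymm F0) (hFs : ∀ l, TSymm (F l))
    (P : Matrix (Fin n) (Fin n) ℝ) (hP : IsUnit P.det)
    (hEN0 : EssNonpos (pmul P F0)) (hEN : ∀ l, EssNonpos (pmul P (F l)))
    (hslater : ∃ x0 : Fin n → ℝ, ∀ l, tIP (F l) (rk1 m x0) < 0) :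
    (∀ x : Fin n → ℝ, (∀ l, tIP (F l) (rk1 m x) ≤ 0) → 0 ≤ tIP F0 (rk1 m x)) ↔
      (∃ lam : Fin p → ℝ, (∀ l, 0 ≤ lam l) ∧
        IsSOSFun (fun x : Fin n → ℝ => tIP (F0 + ∑ l, lam l • F l) (rk1 m x))) := by
  constructor
  · intro h
    have hinv : ∀ x : Fin n → ℝ, Matrix.vecMul (Matrix.vecMul x P⁻¹) P = x := fun x => by
      rw [Matrix.vecMul_vecMul, Matrix.nonsing_inv_mul P hP, Matrix.vecMul_one]
    obtain ⟨lam, hlam, hnonneg⟩ := exists_multipliers_of_slater (hEN0.sublinearOn hm0)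
      (fun l => (hEN l).sublinearOn hm0)
      (by
        obtain ⟨x0, hx0⟩ := hslater
        refine ⟨fun j => |Matrix.vecMul x0 P⁻¹ j| ^ m,
          (PointedCone.mem_positive ℝ _).2 fun j => pow_nonneg (abs_nonneg _) m, fun l => ?_⟩
        simp only [Real.pow_rpow_inv_natCast (abs_nonneg _) hm0.ne']
        refine ((hEN l).tIP_rk1_abs_le hm hm0 _).trans_lt ?_
        rw [tIP_pmul_rk1, hinv]
        exact hx0 l)
      (by
        intro u _ hl
        simp only [tIP_pmul_rk1] at hl ⊢
        exact h _ hl)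
    refine ⟨lam, hlam, ?_⟩
    have hsos := (hEN0.add_sum_smul hEN hlam).isSumSq hm hm0
      (fun u hu => by
        rw [tIP_add_sum_smul]
        exact hnonneg u ((PointedCone.mem_positive ℝ _).2 hu))
      (fun j => ∑ i, MvPolynomial.C (P⁻¹ i j) * MvPolynomial.X (R := ℝ) i)
    convert hsos.isSOSPoly.isSOSFun using 2 with x
    have hY : ∀ j, MvPolynomial.eval x
        (∑ i, MvPolynomial.C (P⁻¹ i j) * MvPolynomial.X (R := ℝ) i) = Matrix.vecMul x P⁻¹ j := by
      intro j
      simp [Matrix.vecMul, dotProduct, mul_comm]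
    rw [map_sum]
    simp only [MvPolynomial.smul_eval, map_prod, hY]
    change _ = tIP _ (rk1 m (Matrix.vecMul x P⁻¹))
    simp only [tIP_add_sum_smul, tIP_pmul_rk1, hinv]
  · rintro ⟨lam, hlam, r, g, hg⟩ x hx
    have h1 := hg x
    simp only [tIP_add_sum_smul] at h1
    have h2 : 0 ≤ ∑ j, MvPolynomial.eval x (g j) ^ 2 := Finset.sum_nonneg fun j _ => sq_nonneg _
    have h3 : ∑ l, lam l * tIP (F l) (rk1 m x) ≤ 0 :=
      Finset.sum_nonpos fun l _ => mul_nonpos_of_nonneg_of_nonpos (hlam l) (hx l)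
    linarith
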